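/- arXiv:2403.18880 — 13 statements merged into one kernel-verified Lean document; each statement's English description precedes it below -/
import Mathlib

section
/- Let R be a p.q.-Baer *-ring and x ∈ R. Then x has a central cover e ∈ R (that is, e is the smallest central projection with ex = x), and moreover for all y ∈ R the following are equivalent: (i) xry = 0 for all r ∈ R; (ii) yrx = 0 for all r ∈ R; (iii) ey = 0. -/
/-- A projection generating the right annihilator of `aR` is central. -/
theorem central_of_rightAnnihilator_eq {R : Type*} [Ring R] [StarRing R] {a g : R}
    (hs : star g = g) (hg : g * g = g)
    (ha : ∀ y : R, (∀ r : R, a * r * y = 0) ↔ g * y = y) (r : R) : g * r = r * g := by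
  have left_mul (r : R) : g * (r * g) = r * g :=
    (ha _).1 fun s => by simpa only [mul_assoc] using (ha g).2 hg (s * r)
  have right_mul : g * r * g = g * r := by
    simpa only [star_mul, star_star, hs] using congrArg star (left_mul (star r))
  rw [← right_mul, mul_assoc, left_mul]

/-- In a p.q.-Baer *-ring `R`, every `x ∈ R` has a central cover `e`, and moreover for all `y`:
`xRy = 0` iff `yRx = 0` iff `ey = 0`. -/
theorem pqBaer_central_cover_exists {R : Type*} [Ring R] [StarRing R]
    (hpq : ∀ a : R, ∃ e : R, (star e = e ∧ e * e = e) ∧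
      ∀ y : R, (∀ r : R, a * r * y = 0) ↔ e * y = y)
    (x : R) :
    ∃ e : R, ((star e = e ∧ e * e = e) ∧ (∀ r : R, e * r = r * e)) ∧ e * x = x ∧
      (∀ f : R, ((star f = f ∧ f * f = f) ∧ (∀ r : R, f * r = r * f)) → f * x = x → e * f = e) ∧
      (∀ y : R, ((∀ r : R, x * r * y = 0) ↔ e * y = 0) ∧
        ((∀ r : R, y * r * x = 0) ↔ e * y = 0)) := by
  obtain ⟨g, ⟨hs, hg⟩, hx⟩ := hpq x
  have hc := central_of_rightAnnihilator_eq hs hg hx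
  have hxg : g * x = 0 := by
    simpa [hc x] using (hx g).2 hg 1
  have hmin (f : R) (hfc : ∀ r : R, f * r = r * f) (hfx : f * x = x) :
      (1 - g) * f = 1 - g := by
    have h : g * (1 - f) = 1 - f := (hx _).1 fun r => by
      rw [mul_sub, mul_one, ← hfc, ← mul_assoc, hfx, sub_self]
    rw [mul_sub, mul_one] at h
    rw [sub_mul, one_mul]
    rw [sub_eq_sub_iff_add_eq_add] at h ⊢
    simpa only [add_comm] using h
  refine ⟨1 - g, ⟨⟨by simp [hs], by simp [mul_sub, sub_mul, hg]⟩, fun r => ?_⟩,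
    by simp [sub_mul, hxg], fun f hf hfx => hmin f hf.2 hfx, fun y => ⟨?_, ?_, fun hy r => ?_⟩⟩
  · rw [sub_mul, mul_sub, one_mul, mul_one, hc]
  · rw [hx, sub_mul, one_mul, sub_eq_zero, eq_comm]
  · intro hyx
    obtain ⟨h, ⟨hhs, hh⟩, hy⟩ := hpq y
    have hhc := central_of_rightAnnihilator_eq hhs hh hy
    have hyh : h * y = 0 := by
      simpa [hhc y] using (hy h).2 hh 1
    rw [← hmin h hhc ((hy x).1 hyx), mul_assoc, hyh, mul_zero]
  · have hgy : g * y = y := by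
      rwa [sub_mul, one_mul, sub_eq_zero, eq_comm] at hy
    rw [← hgy, mul_assoc, mul_assoc, hc, mul_assoc, mul_assoc, ← hc x, hxg, mul_zero, mul_zero]
end

section
/- If R is a p.q.-Baer *-ring, i.e. a not-necessarily-unital *-ring such that for every a ∈ R there exists a projection e with: for all y ∈ R, (ary = 0 for all r ∈ R) if and only if ey = y, then R has a unity element (an element u with ux = xu = x for all x ∈ R) and the involution of R is semi-proper (if ara* = 0 for all r ∈ R then a = 0). -/
/-- If `R` is a p.q.-Baer *-ring (not necessarily unital), then `R` has a unity element
and the involution of `R` is semi-proper. -/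
theorem pqBaer_star_ring_has_one_and_semiProper {R : Type*} [NonUnitalRing R] [StarRing R]
    (hpq : ∀ a : R, ∃ e : R, (star e = e ∧ e * e = e) ∧
      ∀ y : R, (∀ r : R, a * r * y = 0) ↔ e * y = y) :
    (∃ u : R, ∀ x : R, u * x = x ∧ x * u = x) ∧
      (∀ a : R, (∀ r : R, a * r * star a = 0) → a = 0) := by
  obtain ⟨u, ⟨hu, -⟩, h⟩ := hpq 0
  have hl (x : R) : u * x = x := (h x).mp fun r => by simp
  have hr (x : R) : x * u = x := by simpa [hu] using congrArg star (hl (star x))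
  refine ⟨⟨u, fun x => ⟨hl x, hr x⟩⟩, fun a ha => ?_⟩
  obtain ⟨e, ⟨he, hee⟩, h'⟩ := hpq a
  have h₁ : a * e = a := by simpa [he] using congrArg star ((h' (star a)).mp ha)
  have h₂ : a * u * e = 0 := (h' e).mpr hee u
  rwa [hr, h₁] at h₂
end

section
/- For a not-necessarily-unital *-ring R the following are equivalent: (a) R is a p.q.-Baer *-ring, i.e. for every a ∈ R there exists a projection e with: for all y ∈ R, (ary = 0 for all r ∈ R) if and only if ey = y; (b) R has a unity element and R is a weakly p.q.-Baer *-ring, i.e. every x ∈ R has a central cover e such that for all y ∈ R: (xry = 0 for all r ∈ R) if and only if ey = 0. -/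
/-- For a (not necessarily unital) *-ring `R`: `R` is a p.q.-Baer *-ring if and only if
`R` has a unity element and `R` is a weakly p.q.-Baer *-ring. -/
theorem pqBaer_iff_unital_weakly_pqBaer {R : Type*} [NonUnitalRing R] [StarRing R] :
    (∀ a : R, ∃ e : R, (star e = e ∧ e * e = e) ∧
      ∀ y : R, (∀ r : R, a * r * y = 0) ↔ e * y = y) ↔
      ((∃ u : R, ∀ x : R, u * x = x ∧ x * u = x) ∧
        (∀ x : R, ∃ e : R,
          (((star e = e ∧ e * e = e) ∧ (∀ r : R, e * r = r * e)) ∧ e * x = x ∧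
            (∀ f : R, ((star f = f ∧ f * f = f) ∧ (∀ r : R, f * r = r * f)) →
              f * x = x → e * f = e)) ∧
          (∀ y : R, (∀ r : R, x * r * y = 0) ↔ e * y = 0))) := by
  constructor
  · intro h
    obtain ⟨u, ⟨hus, -⟩, hu⟩ := h 0
    have hul : ∀ x : R, u * x = x := fun x => (hu x).1 fun r => by simp
    have hur : ∀ x : R, x * u = x := fun x => by
      have := congrArg star (hul (star x))
      rwa [star_mul, star_star, hus] at this
    refine ⟨⟨u, fun x => ⟨hul x, hur x⟩⟩, fun x => ?_⟩
    obtain ⟨e, ⟨hes, hee⟩, he⟩ := h x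
    have hxe : ∀ r : R, x * r * e = 0 := (he e).2 hee
    have hese : ∀ s : R, e * (s * e) = s * e := fun s =>
      (he (s * e)).1 fun r => by
        rw [← mul_assoc, mul_assoc x r s]
        exact hxe (r * s)
    have hcomm : ∀ s : R, e * s = s * e := fun s => by
      have := congrArg star (hese (star s))
      simp only [star_mul, star_star, hes] at this
      rw [← this, mul_assoc, hese]
    have hex : e * x = 0 := by
      rw [hcomm]
      simpa only [hur] using hxe u
    refine ⟨u - e, ⟨⟨⟨?_, ?_⟩, ?_⟩, ?_, ?_⟩, ?_⟩
    · rw [star_sub, hus, hes]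
    · rw [sub_mul, hul, mul_sub, hur, hee, sub_self, sub_zero]
    · intro r
      rw [sub_mul, mul_sub, hul, hur, hcomm]
    · rw [sub_mul, hul, hex, sub_zero]
    · rintro f ⟨-, hf⟩ hfx
      have key := (he (u - f)).1 fun r => by
        rw [mul_sub, hur, ← hf, ← mul_assoc, hfx, sub_self]
      rw [mul_sub, hur] at key
      rw [sub_mul, hul, sub_eq_sub_iff_add_eq_add]
      rw [sub_eq_sub_iff_add_eq_add] at key
      rw [add_comm f e, key]
    · intro y
      rw [he y, sub_mul, hul, sub_eq_zero, eq_comm]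
  · rintro ⟨⟨u, hu⟩, h⟩ a
    have hus : star u = u := by
      have := congrArg star (hu (star u)).1
      rw [star_mul, star_star, (hu (star u)).1] at this
      exact this
    obtain ⟨e, ⟨⟨⟨hes, hee⟩, -⟩, -⟩, he⟩ := h a
    refine ⟨u - e, ⟨?_, ?_⟩, fun y => ?_⟩
    · rw [star_sub, hus, hes]
    · rw [sub_mul, (hu _).1, mul_sub, (hu e).2, hee, sub_self, sub_zero]
    · rw [he y, sub_mul, (hu y).1, sub_eq_self]
end

section
/- Let R be a weakly Rickart *-ring and suppose there exists a commutative *-ring K with unity which is an integral domain such that R is a *-algebra over K and R is a torsion-free K-module. Then R can be embedded in a Rickart *-ring with preservation of right projections: there exist a Rickart *-ring S and an injective additive, multiplicative, star-preserving map φ : R → S such that whenever e is the right projection of a in R (ae = a and for all y ∈ R, ay = 0 implies ey = 0), φ(e) is the right projection of φ(a) in S (φ(a)φ(e) = φ(a) and for all w ∈ S, φ(a)w = 0 implies φ(e)w = 0). -/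
universe u v

/-- `e` is the right projection of `x`: a projection with `x * e = x` that annihilates on the left
whatever `x` does. -/
def IsRightProjection {R : Type*} [NonUnitalRing R] [StarRing R] (x e : R) : Prop :=
  (star e = e ∧ e * e = e) ∧ x * e = x ∧ ∀ y : R, x * y = 0 → e * y = 0

namespace IsRightProjection

variable {R : Type*} [NonUnitalRing R] [StarRing R]

/-- In a weakly Rickart *-ring the involution is proper. -/
theorem eq_zero_of_star_mul_self (hwR : ∀ x : R, ∃ e : R, IsRightProjection x e) {x : R}
    (hx : star x * x = 0) : x = 0 := by
  obtain ⟨e, ⟨hs, -⟩, he, h⟩ := hwR (star x)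
  have hex : e * x = x := by simpa [hs] using congrArg star he
  rw [← hex, h x hx]

/-- The right projection of `x` lies below every projection that fixes `x` on the right. -/
theorem projection_mul_eq (hwR : ∀ x : R, ∃ e : R, IsRightProjection x e) {x f e : R}
    (hf : IsRightProjection x f) (hes : star e = e) (hee : e * e = e) (hxe : x * e = x) :
    e * f = f := by
  obtain ⟨⟨hfs, hff⟩, -, h⟩ := hf
  have hfef : f * (f - e * f) = 0 := h _ (by rw [mul_sub, ← mul_assoc, hxe, sub_self])
  have hz : f - e * f = 0 := by
    apply eq_zero_of_star_mul_self hwR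
    have h2 : e * (f - e * f) = 0 := by rw [mul_sub, ← mul_assoc, hee, sub_self]
    rw [star_sub, star_mul, hfs, hes, sub_mul, hfef, mul_assoc, h2, mul_zero, sub_zero]
  exact (sub_eq_zero.mp hz).symm

/-- In a weakly Rickart *-ring every element is fixed on both sides by some projection. -/
theorem exists_two_sided (hwR : ∀ x : R, ∃ e : R, IsRightProjection x e) (a : R) :
    ∃ e : R, star e = e ∧ e * e = e ∧ a * e = a ∧ e * a = a := by
  obtain ⟨p, ⟨hps, hpp⟩, hap, -⟩ := hwR a
  obtain ⟨q, ⟨hqs, hqq⟩, haq, hq⟩ := hwR (star a - star a * p)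
  have hqp : q * p = 0 := hq p (by rw [sub_mul, mul_assoc, hpp, sub_self])
  have hpq : p * q = 0 := by simpa [hps, hqs] using congrArg star hqp
  rw [sub_mul, mul_assoc, hpq, mul_zero, sub_zero] at haq
  refine ⟨p + q, by rw [star_add, hps, hqs], ?_, ?_, ?_⟩
  · rw [add_mul, mul_add, mul_add, hpp, hqq, hpq, hqp, add_zero, zero_add]
  · have haq' : a * q = 0 := by rw [← hap, mul_assoc, hpq, mul_zero]
    rw [mul_add, hap, haq', add_zero]
  · have h : star a * (p + q) = star a := by rw [mul_add, haq, add_sub_cancel]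
    simpa [hps, hqs] using congrArg star h

variable {K : Type*} [CommRing K] [Module K R] [SMulCommClass K R R]

/-- The right projection of `a` annihilates whatever `a` does, also in the unitization. -/
theorem inr_mul_eq_zero {a e : R} (he : IsRightProjection a e) {w : Unitization K R}
    (hw : (a : Unitization K R) * w = 0) : (e : Unitization K R) * w = 0 := by
  obtain ⟨⟨-, hee⟩, hae, h⟩ := he
  have h1 := (Unitization.ext_iff.mp hw).2
  simp only [Unitization.snd_mul, Unitization.fst_inr, Unitization.snd_inr, zero_smul, zero_add,
    Unitization.snd_zero] at h1
  have h2 := h (w.fst • e + w.snd) (by rw [mul_add, mul_smul_comm, hae, h1])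
  rw [mul_add, mul_smul_comm, hee] at h2
  ext
  · simp
  · simpa using h2

/-- If `x` has nonzero scalar part, its right annihilator in the unitization is generated by a
projection of `R`. -/
theorem exists_annihilator_of_fst_ne_zero [IsScalarTower K R R] [IsDomain K]
    (hwR : ∀ x : R, ∃ e : R, IsRightProjection x e)
    (htf : ∀ (l : K) (a : R), l • a = 0 → l = 0 ∨ a = 0) {x : Unitization K R}
    (hx : x.fst ≠ 0) :
    ∃ g : R, (star g = g ∧ g * g = g) ∧
      ∀ y : Unitization K R, x * y = 0 ↔ (g : Unitization K R) * y = y := by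
  obtain ⟨e, hes, hee, hae, hea⟩ := exists_two_sided hwR x.snd
  obtain ⟨f, hf⟩ := hwR (x.snd + x.fst • e)
  have hef : e * f = f :=
    projection_mul_eq hwR hf hes hee (by rw [add_mul, smul_mul_assoc, hae, hee])
  obtain ⟨⟨hfs, hff⟩, hcf, h⟩ := hf
  have hfe : f * e = f := by simpa [hes, hfs] using congrArg star hef
  have heg : e * (e - f) = e - f := by rw [mul_sub, hee, hef]
  have hcg : (x.snd + x.fst • e) * (e - f) = 0 := by
    rw [mul_sub, hcf, add_mul, smul_mul_assoc, hae, hee, sub_self]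
  have hxg : x.snd * (e - f) + x.fst • (e - f) = 0 := by
    rwa [add_mul, smul_mul_assoc, heg] at hcg
  refine ⟨e - f, ⟨by rw [star_sub, hes, hfs], ?_⟩, fun y => ⟨fun hy => ?_, fun hy => ?_⟩⟩
  · rw [sub_mul, heg, mul_sub, hfe, hff, sub_self, sub_zero]
  · have h1 : y.fst = 0 := by
      have := (Unitization.ext_iff.mp hy).1
      rw [Unitization.fst_mul, Unitization.fst_zero] at this
      exact (mul_eq_zero.mp this).resolve_left hx
    have h2 : x.fst • y.snd + x.snd * y.snd = 0 := by
      simpa [h1] using (Unitization.ext_iff.mp hy).2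
    have h3 : e * y.snd = y.snd := by
      have h4 : x.fst • (e * y.snd - y.snd) = 0 := by
        rw [smul_sub, ← mul_smul_comm, eq_neg_of_add_eq_zero_left h2, mul_neg, ← mul_assoc, hea,
          sub_self]
      exact sub_eq_zero.mp ((htf _ _ h4).resolve_left hx)
    have h5 : f * y.snd = 0 := h _ (by rw [add_mul, smul_mul_assoc, h3, add_comm, h2])
    ext
    · simp [h1]
    · rw [Unitization.snd_mul, Unitization.fst_inr, Unitization.snd_inr, zero_smul, zero_add, h1,
        zero_smul, zero_add, sub_mul, h3, h5, sub_zero]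
  · have h0 : x * ((e - f : R) : Unitization K R) = 0 := by
      ext
      · rw [Unitization.fst_mul, Unitization.fst_inr, mul_zero, Unitization.fst_zero]
      · rw [Unitization.snd_mul, Unitization.fst_inr, Unitization.snd_inr, zero_smul, add_zero,
          add_comm, hxg, Unitization.snd_zero]
    rw [← hy, ← mul_assoc, h0, zero_mul]

end IsRightProjection

/-- Berberian's partial solution to Problem 1: a weakly Rickart *-ring `R` which is a *-algebra
over an involutive integral domain `K` and a torsion-free `K`-module can be embedded in a
Rickart *-ring with preservation of right projections. -/
theorem weakly_rickart_embeds_of_torsionFree {R : Type u} {K : Type v}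
    [NonUnitalRing R] [StarRing R] [CommRing K] [StarRing K] [IsDomain K]
    [Module K R] [IsScalarTower K R R] [SMulCommClass K R R] [StarModule K R]
    (hwR : ∀ x : R, ∃ e : R, (star e = e ∧ e * e = e) ∧ x * e = x ∧
      ∀ y : R, x * y = 0 → e * y = 0)
    (htf : ∀ (l : K) (a : R), l • a = 0 → l = 0 ∨ a = 0) :
    ∃ (S : Type (max u v)) (_ : NonUnitalRing S) (_ : StarRing S),
      (∀ x : S, ∃ e : S, (star e = e ∧ e * e = e) ∧ ∀ y : S, x * y = 0 ↔ e * y = y) ∧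
      ∃ φ : R → S, Function.Injective φ ∧
        (∀ x y : R, φ (x + y) = φ x + φ y) ∧
        (∀ x y : R, φ (x * y) = φ x * φ y) ∧
        (∀ x : R, φ (star x) = star (φ x)) ∧
        (∀ a e : R, (star e = e ∧ e * e = e) → a * e = a →
          (∀ y : R, a * y = 0 → e * y = 0) →
          (φ a * φ e = φ a ∧ ∀ w : S, φ a * w = 0 → φ e * w = 0)) := by
  have hR : ∀ x : R, ∃ e : R, IsRightProjection x e := hwR
  refine ⟨Unitization K R, inferInstance, inferInstance, fun x => ?_, fun a => (a : Unitization K R),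
    Unitization.inr_injective, fun a b => Unitization.inr_add K a b,
    fun a b => Unitization.inr_mul K a b, fun a => Unitization.inr_star a,
    fun a e he hae h => ⟨by rw [← Unitization.inr_mul, hae], fun w hw =>
      IsRightProjection.inr_mul_eq_zero ⟨he, hae, h⟩ hw⟩⟩
  by_cases hx : x.fst = 0
  · obtain ⟨e, he⟩ := hR x.snd
    have hxa : x = (x.snd : Unitization K R) := Unitization.ext hx rfl
    have hxe : x * (e : Unitization K R) = x := by
      rw [hxa, ← Unitization.inr_mul, he.2.1]
    have hee : (e : Unitization K R) * e = e := by rw [← Unitization.inr_mul, he.1.2]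
    refine ⟨1 - (e : Unitization K R), ⟨?_, ?_⟩, fun y => ?_⟩
    · rw [star_sub, star_one, ← Unitization.inr_star, he.1.1]
    · rw [sub_mul, one_mul, mul_sub, mul_one, hee, sub_self, sub_zero]
    · rw [sub_mul, one_mul, sub_eq_self]
      refine ⟨fun hy => he.inr_mul_eq_zero (by rwa [← hxa]), fun hy => ?_⟩
      rw [← hxe, mul_assoc, hy, mul_zero]
  · obtain ⟨g, ⟨hgs, hgg⟩, hg⟩ := IsRightProjection.exists_annihilator_of_fst_ne_zero hR htf hx
    exact ⟨g, ⟨by rw [← Unitization.inr_star, hgs], by rw [← Unitization.inr_mul, hgg]⟩, hg⟩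
end

section
/- Let R be a weakly Rickart *-ring and suppose there exists a commutative *-ring K with unity which is an integral domain such that R is a *-algebra over K satisfying condition (3): for every λ ∈ K with λ ≠ 0 there exists a projection e_λ ∈ R such that for every x ∈ R with λx = 0 and every projection f with fx = x and (for all y ∈ R, yx = 0 implies yf = 0), one has fe_λ = f. Then R can be embedded in a Rickart *-ring: there exist a Rickart *-ring S and an injective additive, multiplicative, star-preserving map φ : R → S. -/
universe u v

/-- In a weakly Rickart *-ring, `w* w = 0` forces `w = 0`. -/
theorem eq_zero_of_star_mul_self_of_weaklyRickart {R : Type u} [NonUnitalRing R] [StarRing R]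
    (hwR : ∀ x : R, ∃ e : R, (star e = e ∧ e * e = e) ∧ x * e = x ∧
      ∀ y : R, x * y = 0 → e * y = 0) {w : R} (hw : star w * w = 0) : w = 0 := by
  obtain ⟨f, ⟨hf, -⟩, hwf, h⟩ := hwR (star w)
  have hfw : f * w = w := by simpa [hf] using congrArg star hwf
  rw [← hfw, h w hw]

/-- In a weakly Rickart *-ring, any two projections have a common upper bound. -/
theorem exists_projection_ge_ge_of_weaklyRickart {R : Type u} [NonUnitalRing R] [StarRing R]
    (hwR : ∀ x : R, ∃ e : R, (star e = e ∧ e * e = e) ∧ x * e = x ∧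
      ∀ y : R, x * y = 0 → e * y = 0) {e f : R} (he : star e = e ∧ e * e = e)
    (hf : star f = f) :
    ∃ h : R, (star h = h ∧ h * h = h) ∧ (e * h = e ∧ h * e = e) ∧ (f * h = f ∧ h * f = f) := by
  obtain ⟨he, hee⟩ := he
  obtain ⟨g, ⟨hg, hgg⟩, hfg, h⟩ := hwR (f - f * e)
  have hge : g * e = 0 := h e (by rw [sub_mul, mul_assoc, hee, sub_self])
  have heg : e * g = 0 := by simpa [he, hg] using congrArg star hge
  have hfh : f * (e + g) = f := by
    rw [sub_mul, mul_assoc, heg, mul_zero, sub_zero] at hfg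
    rw [mul_add, hfg, add_sub_cancel]
  refine ⟨e + g, ⟨by rw [star_add, he, hg], ?_⟩, ⟨?_, ?_⟩, hfh, ?_⟩
  · simp [mul_add, add_mul, hee, hgg, hge, heg]
  · rw [mul_add, hee, heg, add_zero]
  · rw [add_mul, hee, hge, add_zero]
  · simpa [he, hg, hf] using congrArg star hfh

/-- Thakare–Waphare: a weakly Rickart *-ring `R` which is a *-algebra over an involutive
integral domain `K` satisfying condition (3) can be embedded in a Rickart *-ring. -/
theorem weakly_rickart_embeds_of_condition_three {R : Type u} {K : Type v}
    [NonUnitalRing R] [StarRing R] [CommRing K] [StarRing K] [IsDomain K]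
    [Module K R] [IsScalarTower K R R] [SMulCommClass K R R] [StarModule K R]
    (hwR : ∀ x : R, ∃ e : R, (star e = e ∧ e * e = e) ∧ x * e = x ∧
      ∀ y : R, x * y = 0 → e * y = 0)
    (hcond : ∀ l : K, l ≠ 0 → ∃ el : R, (star el = el ∧ el * el = el) ∧
      ∀ x : R, l • x = 0 → ∀ f : R, (star f = f ∧ f * f = f) → f * x = x →
        (∀ y : R, y * x = 0 → y * f = 0) → f * el = f) :
    ∃ (S : Type (max u v)) (_ : NonUnitalRing S) (_ : StarRing S),
      (∀ x : S, ∃ e : S, (star e = e ∧ e * e = e) ∧ ∀ y : S, x * y = 0 ↔ e * y = y) ∧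
      ∃ φ : R → S, Function.Injective φ ∧
        (∀ x y : R, φ (x + y) = φ x + φ y) ∧
        (∀ x y : R, φ (x * y) = φ x * φ y) ∧
        (∀ x : R, φ (star x) = star (φ x)) := by
  refine ⟨Unitization K R, inferInstance, inferInstance, fun x => ?_,
    fun a => (a : Unitization K R), Unitization.inr_injective, Unitization.inr_add K,
    Unitization.inr_mul K, Unitization.inr_star⟩
  induction x using Unitization.ind with | inl_add_inr l a => ?_
  obtain ⟨e, ⟨he, hee⟩, hae, hann⟩ := hwR a
  by_cases hl : l = 0
  · subst hl
    refine ⟨1 - (e : Unitization K R), ⟨?_, ?_⟩, fun y => ?_⟩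
    · rw [star_sub, star_one, ← Unitization.inr_star, he]
    · have : (e : Unitization K R) * e = e := by rw [← Unitization.inr_mul, hee]
      simp [mul_sub, sub_mul, this]
    induction y using Unitization.ind with | inl_add_inr m b => ?_
    rw [sub_mul, one_mul, sub_eq_self]
    have key : a * b + m • a = 0 ↔ e * b + m • e = 0 := by
      constructor
      · intro h
        have h1 : a * (e * b + m • e) = 0 := by
          rw [mul_add, ← mul_assoc, hae, mul_smul_comm, hae, h]
        simpa [mul_add, ← mul_assoc, hee, mul_smul_comm] using hann _ h1
      · intro h
        have h1 := congrArg (a * ·) h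
        simpa [mul_add, ← mul_assoc, hae, mul_smul_comm] using h1
    simpa [Unitization.ext_iff, add_comm] using key
  · obtain ⟨p, hp, hpl⟩ := hcond l hl
    obtain ⟨f, ⟨hf, -⟩, haf, -⟩ := hwR (star a)
    have hfa : f * a = a := by simpa [hf] using congrArg star haf
    obtain ⟨q, hq, ⟨heq, -⟩, -, hqf⟩ :=
      exists_projection_ge_ge_of_weaklyRickart hwR ⟨he, hee⟩ hf
    obtain ⟨r, ⟨hr, hrr⟩, ⟨hqr, hrq⟩, -, hrp⟩ :=
      exists_projection_ge_ge_of_weaklyRickart hwR hq hp.1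
    have har : a * r = a := by
      rw [← hae, mul_assoc, ← heq, mul_assoc e, hqr]
    have hra : r * a = a := by
      rw [← hfa, ← mul_assoc, ← hqf, ← mul_assoc r, hrq]
    have htors : ∀ w : R, l • w = 0 → r * w = w := by
      intro w hw
      obtain ⟨k, ⟨hk, hkk⟩, hwk, hkann⟩ := hwR (star w)
      have hkw : k * w = w := by simpa [hk] using congrArg star hwk
      have hkp : k * p = k := hpl w hw k ⟨hk, hkk⟩ hkw fun y hy => by
        have h1 : star w * star y = 0 := by rw [← star_mul, hy, star_zero]
        simpa [hk] using congrArg star (hkann _ h1)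
      have hpk : p * k = k := by simpa [hk, hp.1] using congrArg star hkp
      rw [← hkw, ← hpk, ← mul_assoc, ← mul_assoc, hrp]
    obtain ⟨g, ⟨hg, hgg⟩, hcg, hgann⟩ := hwR (a + l • r)
    have hgrg : g * (r * g) = g := by
      have h1 : (a + l • r) * (g - r * g) = 0 := by
        rw [mul_sub, ← mul_assoc, add_mul a _ r, har, smul_mul_assoc, hrr, sub_self]
      have h2 := hgann _ h1
      rw [mul_sub, hgg, sub_eq_zero] at h2
      exact h2.symm
    have hrg : r * g = g := by
      refine (sub_eq_zero.mp (eq_zero_of_star_mul_self_of_weaklyRickart hwR ?_)).symm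
      have h1 : g * r * (r * g) = g := by rw [mul_assoc, ← mul_assoc r, hrr, hgrg]
      rw [star_sub, star_mul, hr, hg, sub_mul, mul_sub, mul_sub, hgg, hgrg, h1, mul_assoc, hgrg]
      simp
    have hgr : g * r = g := by simpa [hr, hg] using congrArg star hrg
    have hhh : (r - g) * (r - g) = r - g := by
      simp [mul_sub, sub_mul, hrr, hgg, hrg, hgr]
    refine ⟨((r - g : R) : Unitization K R), ⟨?_, ?_⟩, fun y => ?_⟩
    · rw [← Unitization.inr_star, star_sub, hr, hg]
    · rw [← Unitization.inr_mul, hhh]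
    induction y using Unitization.ind with | inl_add_inr m b => ?_
    have key : a * b + l • b = 0 ↔ (r - g) * b = b := by
      constructor
      · intro h
        have hrb : r * b = b := by
          have h1 : l • (b - r * b) = 0 := by
            have h2 := congrArg (r * ·) h
            simp only [mul_add, ← mul_assoc, hra, mul_smul_comm, mul_zero] at h2
            rw [smul_sub, ← add_sub_add_left_eq_sub _ _ (a * b), h, h2, sub_zero]
          have h3 := htors _ h1
          rw [mul_sub, ← mul_assoc, hrr, sub_self] at h3
          exact (sub_eq_zero.mp h3.symm).symm
        have h4 : g * b = 0 := hgann b (by rw [add_mul, smul_mul_assoc, hrb, h])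
        rw [sub_mul, hrb, h4, sub_zero]
      · intro h
        have hrb : r * b = b := by
          rw [← h, ← mul_assoc, mul_sub, hrr, hrg]
        have hgb : g * b = 0 := by
          rw [← h, ← mul_assoc, mul_sub, hgg, hgr, sub_self, zero_mul]
        have h5 : (a + l • r) * b = 0 := by rw [← hcg, mul_assoc, hgb, mul_zero]
        rwa [add_mul, smul_mul_assoc, hrb] at h5
    generalize r - g = h at key ⊢
    by_cases hm : m = 0
    · subst hm
      simpa [Unitization.ext_iff, add_comm] using key
    · simp [Unitization.ext_iff, hl, hm, eq_comm]
end

section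
/- Let n ≥ 2 and m ≥ 2 be integers. The matrix ring M_n(ℤ_m) of n×n matrices over ℤ/mℤ, with involution given by matrix transpose, is a Baer *-ring if and only if n = 2, m is squarefree, and every prime factor p of m satisfies p ≡ 3 (mod 4). -/
open Matrix

theorem dotProduct_self_eq_zero_of_baer {R ι : Type*} [CommRing R] [Fintype ι]
    (h : ∀ T : Set (Matrix ι ι R), T.Nonempty →
      ∃ e : Matrix ι ι R, (e.transpose = e ∧ e * e = e) ∧
        ∀ y : Matrix ι ι R, (∀ t ∈ T, t * y = 0) ↔ e * y = y)
    (v : ι → R) (hv : v ⬝ᵥ v = 0) : v = 0 := by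
  let A : Matrix ι ι R := Matrix.of fun _ j => v j
  obtain ⟨e, ⟨hs, hi⟩, he⟩ := h {A} (Set.singleton_nonempty A)
  simp only [Set.mem_singleton_iff, forall_eq] at he
  have hA : A * Aᵀ = 0 := by
    ext i j
    simpa [A, Matrix.mul_apply, dotProduct] using hv
  have h1 : e * Aᵀ = Aᵀ := (he _).1 hA
  have h2 : A * e = 0 := (he _).2 hi
  have h3 : Aᵀ = 0 := by
    rw [← h1]
    simpa [Matrix.transpose_mul, hs] using congrArg Matrix.transpose h2
  funext i
  simpa [A] using congrFun (congrFun h3 i) i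

/-- If `m = k * d` and `(ℤ/m)ⁿ` has no nonzero isotropic vector, then an integer vector `w` such
that `k • w` is isotropic modulo `m` has all its entries divisible by `d`. -/
theorem dvd_of_dvd_sq_mul_sum_sq {n m k d : ℕ} (hm : m ≠ 0) (hkd : m = k * d)
    (h : ∀ v : Fin n → ZMod m, v ⬝ᵥ v = 0 → v = 0) (w : Fin n → ℤ)
    (hw : (m : ℤ) ∣ k ^ 2 * ∑ i, w i ^ 2) (i : Fin n) : (d : ℤ) ∣ w i := by
  have h0 := h (fun i => ((k * w i : ℤ) : ZMod m)) (by
    rw [← ZMod.intCast_zmod_eq_zero_iff_dvd] at hw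
    rw [← hw, dotProduct, Finset.mul_sum, Int.cast_sum]
    refine Finset.sum_congr rfl fun i _ => ?_
    push_cast
    ring)
  have h1 := (ZMod.intCast_zmod_eq_zero_iff_dvd _ _).1 (congrFun h0 i)
  have hk : (k : ℤ) ≠ 0 := by
    rintro hk
    simp_all
  rw [hkd, Nat.cast_mul] at h1
  exact Int.dvd_of_mul_dvd_mul_left hk h1

theorem dvd_of_prime_dvd_sum_sq {n m p : ℕ} (hm : m ≠ 0) (hpm : p ∣ m)
    (h : ∀ v : Fin n → ZMod m, v ⬝ᵥ v = 0 → v = 0) (w : Fin n → ℤ)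
    (hw : (p : ℤ) ∣ ∑ i, w i ^ 2) (i : Fin n) : (p : ℤ) ∣ w i := by
  obtain ⟨k, rfl⟩ := hpm
  refine dvd_of_dvd_sq_mul_sum_sq hm (mul_comm p k) h w ?_ i
  obtain ⟨c, hc⟩ := hw
  exact ⟨k * c, by rw [hc]; push_cast; ring⟩

theorem squarefree_of_anisotropic {n m : ℕ} (hn : 0 < n) (hm : m ≠ 0)
    (h : ∀ v : Fin n → ZMod m, v ⬝ᵥ v = 0 → v = 0) : Squarefree m := by
  rintro x ⟨q, hq⟩
  have h1 := dvd_of_dvd_sq_mul_sum_sq (k := x * q) (d := x) hm (by rw [hq]; ring) h 1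
    (by rw [hq]; exact ⟨q * ∑ i : Fin n, 1 ^ 2, by push_cast; simp; ring⟩) ⟨0, hn⟩
  rw [Pi.one_apply] at h1
  rw [Nat.isUnit_iff, ← Nat.dvd_one]
  exact_mod_cast h1

theorem le_two_of_anisotropic {n m : ℕ} (hm : 2 ≤ m)
    (h : ∀ v : Fin n → ZMod m, v ⬝ᵥ v = 0 → v = 0) : n ≤ 2 := by
  by_contra! hn
  obtain ⟨k, rfl⟩ := Nat.exists_eq_add_of_le' hn
  obtain ⟨p, hp, hpm⟩ := Nat.exists_prime_and_dvd (show m ≠ 1 by omega)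
  have := Fact.mk hp
  obtain ⟨a, b, hab⟩ := ZMod.sq_add_sq p (-1)
  obtain ⟨a, rfl⟩ := ZMod.intCast_surjective a
  obtain ⟨b, rfl⟩ := ZMod.intCast_surjective b
  have h1 : (p : ℤ) ∣ a ^ 2 + b ^ 2 + 1 := by
    rw [← ZMod.intCast_zmod_eq_zero_iff_dvd]
    push_cast
    rw [hab]
    ring
  have h2 := dvd_of_prime_dvd_sum_sq (by omega) hpm h
    (Fin.cons 1 (Fin.cons a (Fin.cons b 0)))
    (by simpa [Fin.sum_univ_succ, add_assoc, add_comm, add_left_comm] using h1) 0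
  simp only [Fin.cons_zero] at h2
  exact hp.one_lt.ne' (Nat.dvd_one.1 (by exact_mod_cast h2))

theorem mod_four_eq_three_of_anisotropic {m p : ℕ} (hm : m ≠ 0) (hp : p.Prime) (hpm : p ∣ m)
    (h : ∀ v : Fin 2 → ZMod m, v ⬝ᵥ v = 0 → v = 0) : p % 4 = 3 := by
  by_contra h3
  have := Fact.mk hp
  obtain ⟨a, ha⟩ := ZMod.exists_sq_eq_neg_one_iff.2 h3
  obtain ⟨a, rfl⟩ := ZMod.intCast_surjective a
  have h1 := dvd_of_prime_dvd_sum_sq hm hpm h ![1, a] (by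
    rw [← ZMod.intCast_zmod_eq_zero_iff_dvd]
    simp [Fin.sum_univ_two, pow_two, ← ha]) 0
  simp only [Matrix.cons_val_zero] at h1
  exact hp.one_lt.ne' (Nat.dvd_one.1 (by exact_mod_cast h1))

/-- Over a field in which `-1` is not a square, the common kernel of a set of `2 × 2` matrices is
the range of an orthogonal projection. -/
theorem exists_projection_of_field {F : Type*} [Field F]
    (hF : ∀ a b : F, a ^ 2 + b ^ 2 = 0 → a = 0 ∧ b = 0) (T : Set (Matrix (Fin 2) (Fin 2) F)) :
    ∃ e : Matrix (Fin 2) (Fin 2) F, (eᵀ = e ∧ e * e = e) ∧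
      ∀ v : Fin 2 → F, (∀ t ∈ T, t *ᵥ v = 0) ↔ e *ᵥ v = v := by
  by_cases hT : ∀ t ∈ T, t = 0
  · refine ⟨1, by simp, fun v => ?_⟩
    simp only [Matrix.one_mulVec, iff_true]
    intro t ht
    simp [hT t ht]
  push Not at hT
  obtain ⟨t₀, ht₀, hne⟩ := hT
  obtain ⟨i, hi⟩ : ∃ i, t₀ i ≠ 0 := by
    by_contra! hc
    exact hne (funext hc)
  set a := t₀ i 0 with ha
  set b := t₀ i 1 with hb
  have hs : a ^ 2 + b ^ 2 ≠ 0 := by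
    intro h
    obtain ⟨h0, h1⟩ := hF _ _ h
    apply hi
    funext j
    fin_cases j
    · exact h0
    · exact h1
  have hker : ∀ v : Fin 2 → F, (∀ t ∈ T, t *ᵥ v = 0) →
      v = ((a * v 1 - b * v 0) / (a ^ 2 + b ^ 2)) • ![-b, a] := by
    intro v hv
    have h0 := congrFun (hv t₀ ht₀) i
    simp only [Matrix.mulVec, dotProduct, Fin.sum_univ_two, Pi.zero_apply, ← ha, ← hb] at h0
    funext j
    fin_cases j
    · simp
      field_simp
      linear_combination a * h0
    · simp
      field_simp
      linear_combination b * h0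
  by_cases hv : ∀ t ∈ T, t *ᵥ ![-b, a] = 0
  · refine ⟨(a ^ 2 + b ^ 2)⁻¹ • !![b ^ 2, -(a * b); -(a * b), a ^ 2], ⟨?_, ?_⟩, fun v => ?_⟩
    · ext i j
      fin_cases i <;> fin_cases j <;> simp
    · ext i j
      fin_cases i <;> fin_cases j <;> simp [Matrix.mul_apply, Fin.sum_univ_two] <;>
        field_simp <;> ring
    · have hev : ((a ^ 2 + b ^ 2)⁻¹ • !![b ^ 2, -(a * b); -(a * b), a ^ 2]) *ᵥ v =
          ((a * v 1 - b * v 0) / (a ^ 2 + b ^ 2)) • ![-b, a] := by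
        funext j
        fin_cases j <;> simp [Matrix.mulVec, dotProduct, Fin.sum_univ_two] <;>
          field_simp <;> ring
      rw [hev]
      refine ⟨fun h => (hker v h).symm, fun h t ht => ?_⟩
      rw [← h, Matrix.mulVec_smul, hv t ht, smul_zero]
  · refine ⟨0, by simp, fun v => ?_⟩
    rw [Matrix.zero_mulVec]
    refine ⟨fun h => ?_, fun h => by simp [← h]⟩
    by_contra hv0
    apply hv
    have hvv := hker v h
    set c := (a * v 1 - b * v 0) / (a ^ 2 + b ^ 2)
    have hc : c ≠ 0 := by
      intro hc
      rw [hc, zero_smul] at hvv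
      exact hv0 hvv.symm
    intro t ht
    have h1 := h t ht
    rw [hvv, Matrix.mulVec_smul] at h1
    exact (smul_eq_zero.1 h1).resolve_left hc

/-- Common kernels of sets of matrices are ranges of orthogonal projections over a product of
rings as soon as this holds over each factor. -/
theorem exists_projection_of_equiv_pi {A ι κ : Type*} [CommRing A] [Fintype ι] {R : κ → Type*}
    [∀ k, CommRing (R k)] (φ : A ≃+* ∀ k, R k)
    (h : ∀ (k : κ) (T : Set (Matrix ι ι (R k))), ∃ e : Matrix ι ι (R k), (eᵀ = e ∧ e * e = e) ∧
      ∀ v : ι → R k, (∀ t ∈ T, t *ᵥ v = 0) ↔ e *ᵥ v = v)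
    (T : Set (Matrix ι ι A)) :
    ∃ e : Matrix ι ι A, (eᵀ = e ∧ e * e = e) ∧
      ∀ v : ι → A, (∀ t ∈ T, t *ᵥ v = 0) ↔ e *ᵥ v = v := by
  let f : ∀ k, A →+* R k := fun k => (Pi.evalRingHom R k).comp φ.toRingHom
  have hf : ∀ x y : A, (∀ k, f k x = f k y) → x = y := fun x y hxy =>
    φ.injective (funext hxy)
  choose E hE hEv using fun k => h k ((fun t => t.map (f k)) '' T)
  let e : Matrix ι ι A := Matrix.of fun i j => φ.symm fun k => E k i j
  have hfe : ∀ k, e.map (f k) = E k := by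
    intro k
    ext i j
    simp [e, f]
  have hvec : ∀ x y : ι → A, x = y ↔ ∀ k, f k ∘ x = f k ∘ y := fun x y =>
    ⟨fun hxy k => by rw [hxy], fun hxy => funext fun i => hf _ _ fun k => congrFun (hxy k) i⟩
  have hmat : ∀ x y : Matrix ι ι A, (∀ k, x.map (f k) = y.map (f k)) → x = y := fun x y hxy =>
    Matrix.ext fun i j => hf _ _ fun k => congrFun (congrFun (hxy k) i) j
  have hmul : ∀ k (t : Matrix ι ι A) (v : ι → A),
      f k ∘ (t *ᵥ v) = t.map (f k) *ᵥ (f k ∘ v) := fun k t v =>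
    funext fun i => RingHom.map_mulVec (f k) t v i
  refine ⟨e, ⟨hmat _ _ fun k => ?_, hmat _ _ fun k => ?_⟩, fun v => ?_⟩
  · rw [Matrix.transpose_map, hfe, (hE k).1]
  · rw [Matrix.map_mul, hfe, (hE k).2]
  · have hz : ∀ k, f k ∘ (0 : ι → A) = 0 := fun k => by
      ext
      simp
    simp only [hvec, hmul, hz, hfe, ← hEv, Set.forall_mem_image]
    exact ⟨fun H k t ht => H t ht k, fun H t ht k => H k ht⟩

theorem exists_projection_zmod {m : ℕ} (hm : Squarefree m)
    (hp : ∀ p : ℕ, p.Prime → p ∣ m → p % 4 = 3) (T : Set (Matrix (Fin 2) (Fin 2) (ZMod m))) :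
    ∃ e : Matrix (Fin 2) (Fin 2) (ZMod m), (eᵀ = e ∧ e * e = e) ∧
      ∀ v : Fin 2 → ZMod m, (∀ t ∈ T, t *ᵥ v = 0) ↔ e *ᵥ v = v := by
  refine exists_projection_of_equiv_pi (ZMod.equivPi m hm.ne_zero) (fun p => ?_) T
  have hpp := Nat.prime_of_mem_primeFactors p.2
  have hpm := Nat.dvd_of_mem_primeFactors p.2
  rw [Nat.factorization_eq_one_of_squarefree hm hpp hpm, pow_one]
  have := Fact.mk hpp
  refine exists_projection_of_field fun a b hab => ?_
  have key : ∀ a b : ZMod p, a ^ 2 + b ^ 2 = 0 → b = 0 := by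
    intro a b hab
    by_contra hb
    refine ZMod.exists_sq_eq_neg_one_iff.1 ⟨a / b, ?_⟩ (hp p hpp hpm)
    field_simp
    linear_combination -hab
  exact ⟨key b a (by rw [add_comm, hab]), key a b hab⟩

/-- `M_n(ℤ_m)` (`n ≥ 2`, `m ≥ 2`), with transpose as involution, is a Baer *-ring if and only if
`n = 2`, `m` is squarefree and every prime factor of `m` is of the form `4k + 3`. -/
theorem matrix_zmod_baer_star_iff (n m : ℕ) (hn : 2 ≤ n) (hm : 2 ≤ m) :
    (∀ T : Set (Matrix (Fin n) (Fin n) (ZMod m)), T.Nonempty →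
      ∃ e : Matrix (Fin n) (Fin n) (ZMod m), (e.transpose = e ∧ e * e = e) ∧
        ∀ y : Matrix (Fin n) (Fin n) (ZMod m), (∀ t ∈ T, t * y = 0) ↔ e * y = y) ↔
      (n = 2 ∧ Squarefree m ∧ ∀ p : ℕ, p.Prime → p ∣ m → p % 4 = 3) := by
  constructor
  · intro h
    have h0 := dotProduct_self_eq_zero_of_baer h
    obtain rfl : n = 2 := le_antisymm (le_two_of_anisotropic hm h0) hn
    exact ⟨rfl, squarefree_of_anisotropic (by omega) (by omega) h0,
      fun p hp hpm => mod_four_eq_three_of_anisotropic (by omega) hp hpm h0⟩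
  · rintro ⟨rfl, hsq, hp⟩ T -
    obtain ⟨e, he, hev⟩ := exists_projection_zmod hsq hp T
    refine ⟨e, he, fun y => ?_⟩
    have hcol : ∀ x z : Matrix (Fin 2) (Fin 2) (ZMod m), x = z ↔ ∀ j, xᵀ j = zᵀ j := fun x z =>
      ⟨fun h j => by rw [h], fun h => Matrix.transpose_injective (funext h)⟩
    have hmul : ∀ (x z : Matrix (Fin 2) (Fin 2) (ZMod m)) j, (x * z)ᵀ j = x *ᵥ zᵀ j :=
      fun x z j => rfl
    have hzero : ∀ j, (0 : Matrix (Fin 2) (Fin 2) (ZMod m))ᵀ j = 0 := fun j => rfl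
    simp only [hcol, hmul, hzero, ← hev]
    exact ⟨fun H j t ht => H t ht j, fun H t ht j => H j t ht⟩
end

section
/- Let m ≥ 2 be an integer. The ring ℤ/mℤ, with the identity map as involution, is a Baer *-ring if and only if m is a squarefree integer. -/
/-- `ℤ_m` (`m ≥ 2`), with the identity involution, is a Baer *-ring if and only if
`m` is squarefree. -/
theorem zmod_baer_star_iff (m : ℕ) (hm : 2 ≤ m) :
    (∀ T : Set (ZMod m), T.Nonempty →
      ∃ e : ZMod m, e * e = e ∧ ∀ y : ZMod m, (∀ t ∈ T, t * y = 0) ↔ e * y = y) ↔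
      Squarefree m := by
  have : NeZero m := ⟨by omega⟩
  constructor
  · intro h
    have hred : IsReduced (ZMod m) := by
      rw [isReduced_iff_pow_one_lt 2 one_lt_two]
      intro x hx
      obtain ⟨e, he, hT⟩ := h {x} (Set.singleton_nonempty x)
      have hxe : x * e = 0 := (hT e).2 he x rfl
      have hex : e * x = x := (hT x).1 fun t ht => by
        rw [Set.mem_singleton_iff.1 ht, ← sq, hx]
      rw [← hex, mul_comm, hxe]
    exact (isReduced_zmod.1 hred).resolve_right (NeZero.ne m)
  · intro hsq T _
    have : IsReduced (ZMod m) := isReduced_zmod.2 (Or.inl hsq)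
    have : IsSemisimpleRing (ZMod m) := IsArtinianRing.isSemisimpleRing_of_isReduced _
    obtain ⟨e, he, hI⟩ :=
      IsSemisimpleRing.ideal_eq_span_idempotent (Submodule.annihilator (Ideal.span T))
    refine ⟨e, he, fun y => ?_⟩
    have hy : (∀ t ∈ T, t * y = 0) ↔ y ∈ Ideal.span {e} := by
      rw [← hI, Ideal.span, Submodule.mem_annihilator_span]
      simp [mul_comm]
    rw [hy, Ideal.mem_span_singleton]
    exact ⟨fun ⟨z, hz⟩ => by rw [hz, ← mul_assoc, he], fun h => ⟨y, h.symm⟩⟩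
end

section
/- Let R be a weakly Rickart *-ring which is a *-algebra over a commutative *-ring K with unity, satisfying condition (3): for every λ ∈ K with λ ≠ 0 there exists a projection e_λ ∈ R such that for every x ∈ R with λx = 0 and every projection f with fx = x and (for all y ∈ R, yx = 0 implies yf = 0), one has fe_λ = f. Then for every self-adjoint element a ∈ R (a* = a) and every λ ∈ K with λ ≠ 0, there exists a largest projection g such that ag = λg; that is, g is a projection with ag = λg, and every projection k with ak = λk satisfies kg = k. -/
/-- In a weakly Rickart *-ring any two projections have a common upper bound. -/
theorem exists_projection_upper_bound {R : Type*} [NonUnitalRing R] [StarRing R]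
    (hwR : ∀ x : R, ∃ e : R, (star e = e ∧ e * e = e) ∧ x * e = x ∧
      ∀ y : R, x * y = 0 → e * y = 0)
    {e f : R} (hf : star f = f ∧ f * f = f) :
    ∃ h : R, (star h = h ∧ h * h = h) ∧ e * h = e ∧ f * h = f := by
  obtain ⟨r, ⟨hrs, hrr⟩, hxr, hr⟩ := hwR (e - e * f)
  have hrf : r * f = 0 := hr f (by rw [sub_mul, mul_assoc, hf.2, sub_self])
  have hfr : f * r = 0 := by simpa [hrs, hf.1] using congrArg star hrf
  refine ⟨f + r, ⟨by rw [star_add, hf.1, hrs], ?_⟩, ?_, ?_⟩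
  · simp [mul_add, add_mul, hf.2, hrr, hrf, hfr]
  · rw [sub_mul, mul_assoc, hfr, mul_zero, sub_zero] at hxr
    rw [mul_add, hxr, add_sub_cancel]
  · rw [mul_add, hf.2, hfr, add_zero]


/-- In a weakly Rickart *-ring `R` which is a *-algebra over a commutative *-ring `K` with unity
satisfying condition (3), for every self-adjoint `a ∈ R` and every `λ ≠ 0` in `K` there exists a
largest projection `g` with `ag = λg`. -/
theorem largest_projection_exists {K : Type*} {R : Type*}
    [CommRing K] [StarRing K] [NonUnitalRing R] [StarRing R] [Module K R]
    [IsScalarTower K R R] [SMulCommClass K R R] [StarModule K R]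
    (hwR : ∀ x : R, ∃ e : R, (star e = e ∧ e * e = e) ∧ x * e = x ∧
      ∀ y : R, x * y = 0 → e * y = 0)
    (hcond : ∀ l : K, l ≠ 0 → ∃ el : R, (star el = el ∧ el * el = el) ∧
      ∀ x : R, l • x = 0 → ∀ f : R, (star f = f ∧ f * f = f) → f * x = x →
        (∀ y : R, y * x = 0 → y * f = 0) → f * el = f)
    (a : R) (ha : star a = a) (l : K) (hl : l ≠ 0) :
    ∃ g : R, (star g = g ∧ g * g = g) ∧ a * g = l • g ∧
      ∀ k : R, (star k = k ∧ k * k = k) → a * k = l • k → k * g = k := by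
  obtain ⟨e, ⟨hes, -⟩, hae, -⟩ := hwR a
  have hea : e * a = a := by simpa [hes, ha] using congrArg star hae
  obtain ⟨p, hp, hpl⟩ := hcond l hl
  have hann : ∀ y : R, l • y = 0 → p * y = y := by
    intro y hy
    obtain ⟨f, ⟨hfs, hff⟩, hyf, hf⟩ := hwR (star y)
    have hfy : f * y = y := by simpa [hfs] using congrArg star hyf
    have hfp : f * p = f := by
      refine hpl y hy f ⟨hfs, hff⟩ hfy fun z hz => ?_
      have hz' : f * star z = 0 := hf _ (by rw [← star_mul, hz, star_zero])
      simpa [hfs] using congrArg star hz'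
    have hpf : p * f = f := by simpa [hfs, hp.1] using congrArg star hfp
    rw [← hfy, ← mul_assoc, hpf]
  obtain ⟨h, ⟨hhs, hhh⟩, heh, hph⟩ := exists_projection_upper_bound hwR (e := e) hp
  have hhe : h * e = e := by simpa [hes, hhs] using congrArg star heh
  have hhp : h * p = p := by simpa [hp.1, hhs] using congrArg star hph
  have hah : a * h = a := by rw [← hae, mul_assoc, heh]
  have hle : ∀ k : R, a * k = l • k → h * k = k := by
    intro k hk
    have hy : l • (k - e * k) = 0 := by
      rw [smul_sub, ← mul_smul_comm, ← hk, ← mul_assoc, hea, sub_self]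
    have hhy : h * (k - e * k) = k - e * k := by
      rw [← hann _ hy, ← mul_assoc, hhp]
    rw [mul_sub, ← mul_assoc, hhe] at hhy
    exact sub_left_injective hhy
  obtain ⟨r, ⟨hrs, hrr⟩, hxr, hr⟩ := hwR (a - l • h)
  have hxh : (a - l • h) * h = a - l • h := by rw [sub_mul, hah, smul_mul_assoc, hhh]
  have hrh : r * h = r := by
    obtain ⟨q, -, hq, -⟩ := hwR (r - r * h)
    have hz : r * (q - h * q) = 0 := hr _ (by rw [mul_sub, ← mul_assoc, hxh, sub_self])
    rw [mul_sub, ← mul_assoc, ← sub_mul, hq] at hz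
    exact (sub_eq_zero.mp hz).symm
  have hhr : h * r = r := by simpa [hrs, hhs] using congrArg star hrh
  have hg : h * (h - r) = h - r := by rw [mul_sub, hhh, hhr]
  refine ⟨h - r, ⟨by rw [star_sub, hhs, hrs], ?_⟩, ?_, ?_⟩
  · rw [sub_mul, hg, mul_sub, hrh, hrr, sub_self, sub_zero]
  · have hz : (a - l • h) * (h - r) = 0 := by rw [mul_sub, hxh, hxr, sub_self]
    rw [sub_mul, smul_mul_assoc, hg] at hz
    exact sub_eq_zero.mp hz
  · rintro k ⟨hks, -⟩ hk
    have hhk := hle k hk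
    have hrk : r * k = 0 := hr k (by rw [sub_mul, smul_mul_assoc, hhk, hk, sub_self])
    have hkh : k * h = k := by simpa [hks, hhs] using congrArg star hhk
    have hkr : k * r = 0 := by simpa [hks, hrs] using congrArg star hrk
    rw [mul_sub, hkh, hkr, sub_zero]
end

section
/- Let K be a commutative *-ring with unity and R a *-algebra over K whose involution is proper (z*z = 0 implies z = 0). If a ∈ R and λ ∈ K satisfy ax + λx = 0 for all x ∈ R, then a*x + λ*x = 0 for all x ∈ R. (Consequently, the formula [a,λ]* = [a*,λ*] unambiguously defines an involution on the quotient R̂₁ of R ⊕ K by the ideal N = {(a,λ) : ax + λx = 0 for all x ∈ R}.) -/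
/-- If `R` is a *-algebra over a commutative *-ring `K` with unity and the involution of `R` is
proper, then `ax + λx = 0` for all `x` implies `a*x + λ*x = 0` for all `x`; hence
`[a,λ]* = [a*,λ*]` unambiguously defines an involution on the quotient `R̂₁`. -/
theorem star_welldefined_on_quotient {K : Type*} {R : Type*}
    [CommRing K] [StarRing K] [NonUnitalRing R] [StarRing R] [Module K R]
    [IsScalarTower K R R] [SMulCommClass K R R] [StarModule K R]
    (hproper : ∀ z : R, star z * z = 0 → z = 0)
    (a : R) (l : K) (h : ∀ x : R, a * x + l • x = 0) :
    ∀ x : R, star a * x + star l • x = 0 := by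
  intro x
  apply hproper
  rw [star_add, star_mul, star_star, star_smul, star_star, add_mul, mul_assoc, smul_mul_assoc,
    ← mul_smul_comm, ← mul_add, h, mul_zero]
end

section
/- Let K be a commutative *-ring with unity and R a *-algebra over K whose involution is proper (z*z = 0 implies z = 0). If a ∈ R and λ ∈ K satisfy (a*a)x + λ(a*x) + λ*(ax) + (λ*λ)x = 0 for all x ∈ R (i.e. [a,λ]*[a,λ] = 0 in the quotient R̂₁), then ax + λx = 0 for all x ∈ R (i.e. [a,λ] = 0 in R̂₁). In other words, the induced involution on R̂₁ is proper. -/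
/-- If `R` is a *-algebra over a commutative *-ring `K` with unity whose involution is proper,
and `[a,λ]*[a,λ] = 0` in the quotient `R̂₁` (elementwise: `(a*a)x + λ(a*x) + λ*(ax) + (λ*λ)x = 0`
for all `x`), then `[a,λ] = 0` (elementwise: `ax + λx = 0` for all `x`). That is, the induced
involution on `R̂₁` is proper. -/
theorem quotient_involution_proper {K : Type*} {R : Type*}
    [CommRing K] [StarRing K] [NonUnitalRing R] [StarRing R] [Module K R]
    [IsScalarTower K R R] [SMulCommClass K R R] [StarModule K R]
    (hproper : ∀ z : R, star z * z = 0 → z = 0)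
    (a : R) (l : K)
    (h : ∀ x : R, (star a * a) * x + l • (star a * x) + star l • (a * x) + (star l * l) • x = 0) :
    ∀ x : R, a * x + l • x = 0 := by
  intro x
  apply hproper
  calc star (a * x + l • x) * (a * x + l • x)
      = star x * ((star a * a) * x + l • (star a * x) + star l • (a * x)
          + (star l * l) • x) := by
        simp only [star_add, star_mul, star_smul, add_mul, mul_add, smul_mul_assoc,
          mul_smul_comm, mul_assoc, mul_smul, smul_add]
        rw [smul_comm l (star l)]
        abel
    _ = 0 := by rw [h x, mul_zero]
end

section
/- Let R be a weakly Rickart *-ring and K a commutative *-ring with unity such that R is a *-algebra over K satisfying condition (3): for every λ ∈ K with λ ≠ 0 there exists a projection e_λ ∈ R such that for every x ∈ R with λx = 0 and every projection f with fx = x and (for all y ∈ R, yx = 0 implies yf = 0), one has fe_λ = f. Then R can be embedded in a Rickart *-ring with preservation of right projections: there exist a Rickart *-ring S and an injective additive, multiplicative, star-preserving map φ : R → S such that whenever e is the right projection of a in R (ae = a and for all y ∈ R, ay = 0 implies ey = 0), φ(e) is the right projection of φ(a) in S (φ(a)φ(e) = φ(a) and for all w ∈ S, φ(a)w = 0 implies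 φ(e)w = 0). -/
universe u v

section WeaklyRickart

variable {R : Type u} [NonUnitalRing R] [StarRing R]

/-- In a weakly Rickart *-ring, every element has a left projection. -/
theorem exists_left_projection
    (hwR : ∀ x : R, ∃ e : R, (star e = e ∧ e * e = e) ∧ x * e = x ∧
      ∀ y : R, x * y = 0 → e * y = 0) (x : R) :
    ∃ f : R, (star f = f ∧ f * f = f) ∧ f * x = x ∧ ∀ y : R, y * x = 0 → y * f = 0 := by
  obtain ⟨f, hf, hxf, hmin⟩ := hwR (star x)
  refine ⟨f, hf, ?_, fun y hy ↦ ?_⟩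
  · simpa [hf.1] using congrArg star hxf
  · have h : f * star y = 0 := hmin _ (by rw [← star_mul, hy, star_zero])
    simpa [hf.1] using congrArg star h

/-- The involution of a weakly Rickart *-ring is proper. -/
theorem eq_zero_of_star_mul_self_eq_zero
    (hwR : ∀ x : R, ∃ e : R, (star e = e ∧ e * e = e) ∧ x * e = x ∧
      ∀ y : R, x * y = 0 → e * y = 0) {x : R} (hx : star x * x = 0) : x = 0 := by
  obtain ⟨f, hf, hfx, hmin⟩ := exists_left_projection hwR x
  have h := congrArg star (hmin _ hx)
  simpa [hf.1, hfx] using h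

/-- Any two projections of a weakly Rickart *-ring have a common upper bound. -/
theorem exists_projection_ge
    (hwR : ∀ x : R, ∃ e : R, (star e = e ∧ e * e = e) ∧ x * e = x ∧
      ∀ y : R, x * y = 0 → e * y = 0) {p q : R} (hp : star p = p ∧ p * p = p)
    (hq : star q = q ∧ q * q = q) :
    ∃ g : R, (star g = g ∧ g * g = g) ∧ g * p = p ∧ g * q = q := by
  obtain ⟨r, hr, hyr, hmin⟩ := hwR (q - q * p)
  have hrp : r * p = 0 := hmin p (by rw [sub_mul, mul_assoc, hp.2, sub_self])
  have hpr : p * r = 0 := by simpa [hr.1, hp.1] using congrArg star hrp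
  have hqg : q * (p + r) = q := by
    rw [sub_mul, mul_assoc, hpr, mul_zero, sub_zero] at hyr
    rw [mul_add, hyr, add_sub_cancel]
  have hg : star (p + r) = p + r := by rw [star_add, hp.1, hr.1]
  refine ⟨p + r, ⟨hg, ?_⟩, ?_, ?_⟩
  · simp [mul_add, add_mul, hp.2, hr.2, hpr, hrp]
  · simp [add_mul, hp.2, hrp]
  · simpa only [star_mul, hg, hq.1] using congrArg star hqg

/-- The right projection of `c` lies below every projection `g` with `c * g = c`. -/
theorem right_projection_le
    (hwR : ∀ x : R, ∃ e : R, (star e = e ∧ e * e = e) ∧ x * e = x ∧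
      ∀ y : R, x * y = 0 → e * y = 0) {c f g : R} (hf : star f = f ∧ f * f = f)
    (hmin : ∀ y : R, c * y = 0 → f * y = 0) (hg : star g = g ∧ g * g = g) (hcg : c * g = c) :
    g * f = f ∧ f * g = f := by
  have h : f * (f - g * f) = 0 :=
    hmin _ (by rw [mul_sub, ← mul_assoc, hcg, sub_self])
  have hfgf : f * (g * f) = f := by
    rw [mul_sub, hf.2, sub_eq_zero] at h
    exact h.symm
  have hgf : f - g * f = 0 := by
    apply eq_zero_of_star_mul_self_eq_zero hwR
    have hggf : g * (g * f) = g * f := by rw [← mul_assoc, hg.2]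
    simp [sub_mul, mul_sub, mul_assoc, hf.1, hg.1, hf.2, hfgf, hggf]
  have hgf' : g * f = f := (sub_eq_zero.mp hgf).symm
  exact ⟨hgf', by simpa [hf.1, hg.1] using congrArg star hgf'⟩

/-- A weakly Rickart *-ring with a left identity is a Rickart *-ring. -/
theorem exists_annihilator_projection_of_left_identity
    (hwR : ∀ x : R, ∃ e : R, (star e = e ∧ e * e = e) ∧ x * e = x ∧
      ∀ y : R, x * y = 0 → e * y = 0) {g : R} (hg : star g = g ∧ g * g = g)
    (hgx : ∀ x : R, g * x = x) (x : R) :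
    ∃ e : R, (star e = e ∧ e * e = e) ∧ ∀ y : R, x * y = 0 ↔ e * y = y := by
  obtain ⟨e, he, hxe, hmin⟩ := hwR x
  have heg : e * g = e := by simpa [he.1, hg.1] using congrArg star (hgx e)
  refine ⟨g - e, ⟨by rw [star_sub, hg.1, he.1], ?_⟩, fun y ↦ ⟨fun h ↦ ?_, fun h ↦ ?_⟩⟩
  · simp [sub_mul, mul_sub, hgx, he.2, heg]
  · rw [sub_mul, hgx, hmin y h, sub_zero]
  · rw [sub_mul, hgx, sub_eq_self] at h
    rw [← hxe, mul_assoc, h, mul_zero]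

end WeaklyRickart

section Unitization

variable {R : Type u} {K : Type v} [NonUnitalRing R] [CommRing K]
  [Module K R] [SMulCommClass K R R]

/-- Right projections in `R` remain right projections in its unitization. -/
theorem inr_mul_eq_zero_of_right_projection {a e : R} (he : e * e = e) (hae : a * e = a)
    (hmin : ∀ y : R, a * y = 0 → e * y = 0) {w : Unitization K R}
    (hw : (a : Unitization K R) * w = 0) : (e : Unitization K R) * w = 0 := by
  have h : a * (w.fst • e + w.snd) = 0 := by
    have h := congrArg (fun z : Unitization K R ↦ z.snd) hw
    simpa [mul_add, mul_smul_comm, hae] using h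
  have h2 := hmin _ h
  ext
  · simp
  · simpa [mul_add, mul_smul_comm, he] using h2

variable [StarRing R]

/-- If every `l ≠ 0` in `K` has a projection fixing the `l`-torsion of `R` and `R` has no left
identity projection, then `K` has no zero divisors. -/
theorem eq_zero_or_eq_zero_of_no_left_identity
    (hwR : ∀ x : R, ∃ e : R, (star e = e ∧ e * e = e) ∧ x * e = x ∧
      ∀ y : R, x * y = 0 → e * y = 0)
    (htors : ∀ l : K, l ≠ 0 → ∃ e : R, (star e = e ∧ e * e = e) ∧ ∀ x : R, l • x = 0 → e * x = x)
    (hno : ¬ ∃ g : R, (star g = g ∧ g * g = g) ∧ ∀ x : R, g * x = x) {l m : K}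
    (hlm : l * m = 0) : l = 0 ∨ m = 0 := by
  by_contra! h
  obtain ⟨e, he, hel⟩ := htors l h.1
  obtain ⟨f, hf, hfm⟩ := htors m h.2
  obtain ⟨g, hg, hge, hgf⟩ := exists_projection_ge hwR he hf
  refine hno ⟨g, hg, fun x ↦ ?_⟩
  have h1 : e * (m • x) = m • x := hel _ (by rw [smul_smul, hlm, zero_smul])
  have h2 : f * (x - e * x) = x - e * x :=
    hfm _ (by rw [smul_sub, ← mul_smul_comm, h1, sub_self])
  have h3 : g * (x - e * x) = x - e * x := by
    rw [← h2, ← mul_assoc, hgf]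
  rw [mul_sub, ← mul_assoc, hge] at h3
  exact sub_left_injective h3

variable [IsScalarTower K R R] [StarRing K] [StarModule K R]

/-- The unitization of a weakly Rickart *-ring by a ring without zero divisors, each of whose
nonzero elements has a projection fixing its torsion, is a Rickart *-ring. -/
theorem Unitization.exists_annihilator_projection
    (hwR : ∀ x : R, ∃ e : R, (star e = e ∧ e * e = e) ∧ x * e = x ∧
      ∀ y : R, x * y = 0 → e * y = 0)
    (htors : ∀ l : K, l ≠ 0 → ∃ e : R, (star e = e ∧ e * e = e) ∧ ∀ x : R, l • x = 0 → e * x = x)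
    (hK : ∀ l m : K, l * m = 0 → l = 0 ∨ m = 0) (x : Unitization K R) :
    ∃ e : Unitization K R, (star e = e ∧ e * e = e) ∧
      ∀ y : Unitization K R, x * y = 0 ↔ e * y = y := by
  obtain ⟨a, l, rfl⟩ : ∃ (a : R) (l : K), x = Unitization.inl l + (a : Unitization K R) :=
    ⟨x.snd, x.fst, (Unitization.inl_fst_add_inr_snd_eq x).symm⟩
  by_cases hl : l = 0
  · subst hl
    obtain ⟨e, he, hae, hmin⟩ := hwR a
    have he2 : (e : Unitization K R) * e = e := by rw [← Unitization.inr_mul, he.2]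
    refine ⟨1 - (e : Unitization K R), ⟨?_, ?_⟩, fun y ↦ ?_⟩
    · rw [star_sub, star_one, ← Unitization.inr_star, he.1]
    · simp [sub_mul, mul_sub, he2]
    · rw [Unitization.inl_zero, zero_add, sub_mul, one_mul, sub_eq_self]
      refine ⟨inr_mul_eq_zero_of_right_projection he.2 hae hmin, fun h ↦ ?_⟩
      rw [← hae, Unitization.inr_mul, mul_assoc, h, mul_zero]
  · obtain ⟨p, hp, hpa, -⟩ := exists_left_projection hwR a
    obtain ⟨q, hq, hql⟩ := htors l hl
    obtain ⟨g, hg, hgp, hgq⟩ := exists_projection_ge hwR hp hq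
    have hgb : ∀ b : R, l • b + a * b = 0 → g * b = b := by
      intro b hb
      have h1 : q * (b - p * b) = b - p * b := by
        refine hql _ ?_
        have hb' : l • b = -(a * b) := eq_neg_of_add_eq_zero_left hb
        rw [smul_sub, ← mul_smul_comm, hb', mul_neg, ← mul_assoc, hpa, sub_self]
      have h2 : g * (b - p * b) = b - p * b := by
        rw [← h1, ← mul_assoc, hgq]
      rw [mul_sub, ← mul_assoc, hgp] at h2
      exact sub_left_injective h2
    obtain ⟨f, hf, hcf, hmin⟩ := hwR (l • g + a * g)
    obtain ⟨hgf, hfg⟩ := right_projection_le hwR hf hmin hg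
      (by rw [add_mul, smul_mul_assoc, mul_assoc, hg.2])
    have hcb : ∀ b : R, g * b = b → (l • g + a * g) * b = l • b + a * b := by
      intro b hb
      rw [add_mul, smul_mul_assoc, mul_assoc, hb]
    refine ⟨((g - f : R) : Unitization K R), ⟨?_, ?_⟩, fun y ↦ ?_⟩
    · rw [← Unitization.inr_star, star_sub, hg.1, hf.1]
    · rw [← Unitization.inr_mul]
      simp [sub_mul, mul_sub, hg.2, hf.2, hgf, hfg]
    · obtain ⟨b, m, rfl⟩ : ∃ (b : R) (m : K), y = Unitization.inl m + (b : Unitization K R) :=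
        ⟨y.snd, y.fst, (Unitization.inl_fst_add_inr_snd_eq y).symm⟩
      constructor
      · intro h
        have hm : m = 0 := by
          have h1 := congrArg (fun z : Unitization K R ↦ z.fst) h
          simp only [Unitization.fst_mul, Unitization.fst_add, Unitization.fst_inl,
            Unitization.fst_inr, add_zero, Unitization.fst_zero] at h1
          exact (hK _ _ h1).resolve_left hl
        subst hm
        have hb : l • b + a * b = 0 := by
          simpa using congrArg (fun z : Unitization K R ↦ z.snd) h
        have hgb' := hgb b hb
        have hfb : f * b = 0 := hmin b (by rw [hcb b hgb', hb])
        rw [Unitization.inl_zero, zero_add, ← Unitization.inr_mul, sub_mul, hgb', hfb, sub_zero]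
      · intro h
        have hm : m = 0 := by
          have h1 := congrArg (fun z : Unitization K R ↦ z.fst) h
          simp only [Unitization.fst_mul, Unitization.fst_add, Unitization.fst_inl,
            Unitization.fst_inr, add_zero, zero_mul] at h1
          exact h1.symm
        subst hm
        rw [Unitization.inl_zero, zero_add, ← Unitization.inr_mul] at h
        have hb : (g - f) * b = b := Unitization.inr_injective h
        have hgb' : g * b = b := by
          conv_lhs => rw [← hb, ← mul_assoc, mul_sub, hg.2, hgf]
          exact hb
        have hfb : f * b = 0 := by
          rw [sub_mul, hgb', sub_eq_self] at hb
          exact hb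
        have h0 : l • b + a * b = 0 := by
          rw [← hcb b hgb', ← hcf, mul_assoc, hfb, mul_zero]
        ext
        · simp
        · simpa using h0

end Unitization

/-- Main theorem for Problem 1: a weakly Rickart *-ring `R` which is a *-algebra over a
commutative *-ring `K` with unity satisfying condition (3) can be embedded in a Rickart *-ring
with preservation of right projections. -/
theorem weakly_rickart_embeds_of_commRing_condition_three {R : Type u} {K : Type v}
    [NonUnitalRing R] [StarRing R] [CommRing K] [StarRing K]
    [Module K R] [IsScalarTower K R R] [SMulCommClass K R R] [StarModule K R]
    (hwR : ∀ x : R, ∃ e : R, (star e = e ∧ e * e = e) ∧ x * e = x ∧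
      ∀ y : R, x * y = 0 → e * y = 0)
    (hcond : ∀ l : K, l ≠ 0 → ∃ el : R, (star el = el ∧ el * el = el) ∧
      ∀ x : R, l • x = 0 → ∀ f : R, (star f = f ∧ f * f = f) → f * x = x →
        (∀ y : R, y * x = 0 → y * f = 0) → f * el = f) :
    ∃ (S : Type (max u v)) (_ : NonUnitalRing S) (_ : StarRing S),
      (∀ x : S, ∃ e : S, (star e = e ∧ e * e = e) ∧ ∀ y : S, x * y = 0 ↔ e * y = y) ∧
      ∃ φ : R → S, Function.Injective φ ∧
        (∀ x y : R, φ (x + y) = φ x + φ y) ∧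
        (∀ x y : R, φ (x * y) = φ x * φ y) ∧
        (∀ x : R, φ (star x) = star (φ x)) ∧
        (∀ a e : R, (star e = e ∧ e * e = e) → a * e = a →
          (∀ y : R, a * y = 0 → e * y = 0) →
          (φ a * φ e = φ a ∧ ∀ w : S, φ a * w = 0 → φ e * w = 0)) := by
  by_cases hone : ∃ g : R, (star g = g ∧ g * g = g) ∧ ∀ x : R, g * x = x
  · obtain ⟨g, hg, hgx⟩ := hone
    refine ⟨ULift.{v} R, inferInstance,
      { star := fun x ↦ ULift.up (star x.down)
        star_involutive := fun x ↦ congrArg ULift.up (star_star x.down)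
        star_mul := fun x y ↦ congrArg ULift.up (star_mul x.down y.down)
        star_add := fun x y ↦ congrArg ULift.up (star_add x.down y.down) }, fun x ↦ ?_,
      ULift.up, ULift.up_injective, fun _ _ ↦ rfl, fun _ _ ↦ rfl, fun _ ↦ rfl,
      fun a e _ hae hmin ↦ ⟨congrArg ULift.up hae, fun w hw ↦
        congrArg ULift.up (hmin w.down (congrArg ULift.down hw))⟩⟩
    obtain ⟨e, he, hxe⟩ := exists_annihilator_projection_of_left_identity hwR hg hgx x.down
    exact ⟨ULift.up e, ⟨congrArg ULift.up he.1, congrArg ULift.up he.2⟩, fun y ↦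
      ⟨fun h ↦ congrArg ULift.up ((hxe y.down).1 (congrArg ULift.down h)),
        fun h ↦ congrArg ULift.up ((hxe y.down).2 (congrArg ULift.down h))⟩⟩
  · have htors : ∀ l : K, l ≠ 0 →
        ∃ e : R, (star e = e ∧ e * e = e) ∧ ∀ x : R, l • x = 0 → e * x = x := by
      intro l hl
      obtain ⟨e, he, h⟩ := hcond l hl
      refine ⟨e, he, fun x hx ↦ ?_⟩
      obtain ⟨f, hf, hfx, hmin⟩ := exists_left_projection hwR x
      have hef : e * f = f := by
        simpa [hf.1, he.1] using congrArg star (h x hx f hf hfx hmin)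
      rw [← hfx, ← mul_assoc, hef]
    refine ⟨Unitization K R, inferInstance, inferInstance,
      Unitization.exists_annihilator_projection hwR htors fun _ _ ↦
        eq_zero_or_eq_zero_of_no_left_identity hwR htors hone,
      Unitization.inr, Unitization.inr_injective, Unitization.inr_add K, Unitization.inr_mul K,
      Unitization.inr_star, fun a e he hae hmin ↦ ⟨?_, fun w hw ↦
        inr_mul_eq_zero_of_right_projection he.2 hae hmin hw⟩⟩
    rw [← Unitization.inr_mul, hae]
end

section
/- Let R be a weakly p.q.-Baer *-ring which is a *-algebra over a commutative *-ring K with unity, satisfying condition (β): for every λ ∈ K with λ ≠ 0 there exists a projection e_λ ∈ R such that for every x ∈ R with λx = 0, the central cover C(x) satisfies C(x)e_λ = C(x). Then for every a ∈ R and every λ ∈ K with λ ≠ 0, there exists a largest central projection g such that ag = λg; that is, g is a central projection with ag = λg, and every central projection k with ak = λk satisfies kg = k. -/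
/-- `e` is the central cover of `x`: `e` is the smallest central projection with `ex = x`. -/
def IsCentralCover {R : Type*} [NonUnitalRing R] [StarRing R] (e x : R) : Prop :=
  ((star e = e ∧ e * e = e) ∧ (∀ r : R, e * r = r * e)) ∧ e * x = x ∧
    ∀ f : R, ((star f = f ∧ f * f = f) ∧ (∀ r : R, f * r = r * f)) → f * x = x → e * f = e

/-- `e` is a central projection. -/
abbrev IsCentralProjection {R : Type*} [NonUnitalRing R] [StarRing R] (e : R) : Prop :=
  (star e = e ∧ e * e = e) ∧ ∀ r : R, e * r = r * e

namespace IsCentralProjection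

variable {R : Type*} [NonUnitalRing R] [StarRing R] {c d : R}

theorem mul (hc : IsCentralProjection c) (hd : IsCentralProjection d) :
    IsCentralProjection (c * d) := by
  obtain ⟨⟨hcs, hci⟩, hcc⟩ := hc
  obtain ⟨⟨hds, hdi⟩, hdc⟩ := hd
  refine ⟨⟨by rw [star_mul, hcs, hds, hdc], ?_⟩, fun r => ?_⟩
  · rw [mul_assoc, ← mul_assoc d, hdc c, mul_assoc c d d, hdi, ← mul_assoc, hci]
  · rw [mul_assoc, hdc r, ← mul_assoc, hcc r, mul_assoc]

theorem sub (hc : IsCentralProjection c) (hd : IsCentralProjection d) (h : d * c = d) :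
    IsCentralProjection (c - d) := by
  refine ⟨⟨by rw [star_sub, hc.1.1, hd.1.1], ?_⟩, fun r => ?_⟩
  · rw [sub_mul, mul_sub, mul_sub, hc.1.2, hd.1.2, hc.2 d, h, sub_self, sub_zero]
  · rw [sub_mul, mul_sub, hc.2, hd.2]

theorem sub_mul_self (hc : IsCentralProjection c) (hd : IsCentralProjection d) :
    IsCentralProjection (c - d * c) :=
  hc.sub (hd.mul hc) (by rw [mul_assoc, hc.1.2])

theorem add (hc : IsCentralProjection c) (hd : IsCentralProjection d) (h : c * d = 0) :
    IsCentralProjection (c + d) := by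
  refine ⟨⟨by rw [star_add, hc.1.1, hd.1.1], ?_⟩, fun r => ?_⟩
  · rw [add_mul, mul_add, mul_add, hc.1.2, hd.1.2, hd.2 c, h, add_zero, zero_add]
  · rw [add_mul, mul_add, hc.2, hd.2]

theorem sup (hc : IsCentralProjection c) (hd : IsCentralProjection d) :
    IsCentralProjection (c + (d - c * d)) :=
  hc.add (hd.sub_mul_self hc) (by rw [mul_sub, ← mul_assoc, hc.1.2, sub_self])

theorem isCentralCover_self (hc : IsCentralProjection c) : IsCentralCover c c :=
  ⟨hc, hc.1.2, fun f _ hf => by rw [hc.2, hf]⟩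

end IsCentralProjection

/-- In a weakly p.q.-Baer *-ring `R` which is a *-algebra over a commutative *-ring `K` with
unity satisfying condition (β), for every `a ∈ R` and every `λ ≠ 0` in `K` there exists a
largest central projection `g` such that `ag = λg`. -/
theorem largest_central_projection_exists {K : Type*} {R : Type*}
    [CommRing K] [StarRing K] [NonUnitalRing R] [StarRing R] [Module K R]
    [IsScalarTower K R R] [SMulCommClass K R R] [StarModule K R]
    (hw : ∀ x : R, ∃ e : R, IsCentralCover e x ∧
      ∀ y : R, (∀ r : R, x * r * y = 0) ↔ e * y = 0)
    (hβ : ∀ l : K, l ≠ 0 → ∃ el : R, (star el = el ∧ el * el = el) ∧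
      ∀ x : R, l • x = 0 → ∀ c : R, IsCentralCover c x → c * el = c)
    (a : R) (l : K) (hl : l ≠ 0) :
    ∃ g : R, ((star g = g ∧ g * g = g) ∧ (∀ r : R, g * r = r * g)) ∧ a * g = l • g ∧
      ∀ k : R, ((star k = k ∧ k * k = k) ∧ (∀ r : R, k * r = r * k)) →
        a * k = l • k → k * g = k := by
  obtain ⟨e, -, he⟩ := hβ l hl
  obtain ⟨c, ⟨hc, hca, -⟩, -⟩ := hw a
  obtain ⟨d, ⟨hd, hde, -⟩, -⟩ := hw e
  replace hc : IsCentralProjection c := hc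
  replace hd : IsCentralProjection d := hd
  have hsup : ∃ w : R, IsCentralProjection w ∧
      ∀ k : R, IsCentralProjection k → a * k = l • k → k * w = k := by
    refine ⟨_, hc.sup hd, fun k hk hak => ?_⟩
    have hlk : l • (k - c * k) = 0 := by
      rw [smul_sub, ← mul_smul_comm, ← hak, ← mul_assoc, hca, sub_self]
    have hke := he _ hlk _ (hk.sub_mul_self hc).isCentralCover_self
    have hkd : (k - c * k) * d = k - c * k := by
      rw [← hke, mul_assoc, ← hd.2 e, hde]
    rw [mul_add, mul_sub, ← mul_assoc, ← hc.2 k, ← sub_mul, hkd, add_sub_cancel]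
  obtain ⟨w, hwp, hkw⟩ := hsup
  obtain ⟨h, ⟨hh, hhx, hmin⟩, hann⟩ := hw (a * w - l • w)
  replace hh : IsCentralProjection h := hh
  have hhw : h * w = h := hmin w hwp <| by
    rw [mul_sub, mul_smul_comm, hwp.1.2, hwp.2, mul_assoc, hwp.1.2]
  refine ⟨w - h, hwp.sub hh hhw, ?_, fun k hk hak => ?_⟩
  · have hxg : (a * w - l • w) * (w - h) = 0 := by
      rw [mul_sub, ← hh.2, hhx, sub_mul, mul_assoc, smul_mul_assoc, hwp.1.2, sub_self]
    have hwg : w * (w - h) = w - h := by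
      rw [mul_sub, hwp.1.2, hwp.2, hhw]
    rwa [sub_mul, mul_assoc, smul_mul_assoc, hwg, sub_eq_zero] at hxg
  · have hk' : w * k = k := by rw [hwp.2, hkw k hk hak]
    have hhk : h * k = 0 := (hann k).1 fun r => by
      rw [mul_assoc, ← hk.2, ← mul_assoc, sub_mul, mul_assoc, smul_mul_assoc, hk', hak,
        sub_self, zero_mul]
    rw [mul_sub, hkw k hk hak, ← hh.2, hhk, sub_zero]
end

section
/- Let K be a commutative *-ring with unity and R a weakly p.q.-Baer *-ring which is a *-algebra over K. Let a ∈ R and let e = C(a) be the central cover of a. Then ae = a, and for all b ∈ R and μ ∈ K the following are equivalent: (i) (ax + λa)(bz + μz) = 0 for all x, z ∈ R and all λ ∈ K; (ii) (eb)z + μ(ez) = 0 for all z ∈ R. (That is, [a,0]·R̂₁·[b,μ] = 0 if and only if [e,0][b,μ] = 0 in the quotient R̂₁, so C([a,0]) = [e,0].) -/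
theorem IsCentralCover.unique {R : Type*} [NonUnitalRing R] [StarRing R] {e f x : R}
    (he : IsCentralCover e x) (hf : IsCentralCover f x) : e = f := by
  rw [← he.2.2 f hf.1 hf.2.1, he.1.2 f]
  exact hf.2.2 e he.1 he.2.1

/-- Let `R` be a weakly p.q.-Baer *-ring which is a *-algebra over a commutative *-ring `K` with
unity, `a ∈ R` and `e = C(a)` its central cover. Then `ae = a` and, for all `b ∈ R`, `μ ∈ K`:
`(ax + λa)(bz + μz) = 0` for all `x, z ∈ R`, `λ ∈ K` iff `(eb)z + μ(ez) = 0` for all `z ∈ R`;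
that is, `C([a,0]) = [e,0]` in the quotient `R̂₁`. -/
theorem quotient_central_cover_preserved {K : Type*} {R : Type*}
    [CommRing K] [StarRing K] [NonUnitalRing R] [StarRing R] [Module K R]
    [IsScalarTower K R R] [SMulCommClass K R R] [StarModule K R]
    (hw : ∀ x : R, ∃ e : R, IsCentralCover e x ∧
      ∀ y : R, (∀ r : R, x * r * y = 0) ↔ e * y = 0)
    (a e : R) (he : IsCentralCover e a) :
    a * e = a ∧ ∀ (b : R) (μ : K),
      ((∀ (x z : R) (l : K), (a * x + l • a) * (b * z + μ • z) = 0) ↔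
        (∀ z : R, (e * b) * z + μ • (e * z) = 0)) := by
  obtain ⟨f, hf, hann⟩ := hw a
  obtain rfl : e = f := he.unique hf
  have hae : a * e = a := by rw [← he.1.2 a, he.2.1]
  refine ⟨hae, fun b μ => ?_⟩
  have key : ∀ z : R, (e * b) * z + μ • (e * z) = e * (b * z + μ • z) := fun z => by
    rw [mul_add, mul_assoc, mul_smul_comm]
  simp only [key]
  refine ⟨fun h z => (hann _).1 fun x => ?_, fun h x z l => ?_⟩
  · simpa using h x z 0
  · have hay : a * (b * z + μ • z) = 0 := by
      rw [← hae, mul_assoc, h z, mul_zero]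
    rw [add_mul, (hann _).2 (h z) x, smul_mul_assoc, hay, smul_zero, add_zero]
end
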